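/- There exists a 2-connected chordal graph that admits no CDS partition of size 2. -/

import Mathlib

/-- A graph `G` is `k`-connected: it has more than `k` vertices and deleting any
set of fewer than `k` vertices leaves a connected graph. -/
def KConnected {V : Type} [Fintype V] (G : SimpleGraph V) (k : ℕ) : Prop :=
  k < Fintype.card V ∧
    ∀ S : Finset V, S.card < k → (G.induce ((↑S : Set V)ᶜ)).Connected

/-- `D` is a connected dominating set of `G`. -/
def IsCDS {V : Type} (G : SimpleGraph V) (D : Set V) : Prop :=
  (G.induce D).Connected ∧ ∀ v : V, v ∈ D ∨ ∃ u ∈ D, G.Adj v u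

/-- `G` admits a CDS partition of size `k`. -/
def HasCDSPartition {V : Type} (G : SimpleGraph V) (k : ℕ) : Prop :=
  ∃ D : Fin k → Set V,
    (Pairwise fun i j => Disjoint (D i) (D j)) ∧
    (⋃ i, D i) = Set.univ ∧
    ∀ i, IsCDS G (D i)

/-- `G` is chordal: it has no induced cycle of length at least `4`. -/
def IsChordal {V : Type} (G : SimpleGraph V) : Prop :=
  ¬ ∃ (v : V) (c : G.Walk v v), c.IsCycle ∧ 4 ≤ c.length ∧
      ∀ x ∈ c.support, ∀ y ∈ c.support, G.Adj x y → s(x, y) ∈ c.edges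

/-- Every vertex of a chordless cycle of length at least `4` has two distinct non-adjacent
neighbours on the cycle. -/
theorem exists_nonadj_neighbors_of_chordless_cycle {V : Type} {G : SimpleGraph V} {v : V}
    {c : G.Walk v v} (hc : c.IsCycle) (hlen : 4 ≤ c.length)
    (hch : ∀ x ∈ c.support, ∀ y ∈ c.support, G.Adj x y → s(x, y) ∈ c.edges)
    {u : V} (hu : u ∈ c.support) :
    ∃ x ∈ c.support, ∃ y ∈ c.support, G.Adj u x ∧ G.Adj u y ∧ x ≠ y ∧ ¬ G.Adj x y := by
  classical
  wlog huv : u = v generalizing v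
  · have hs : ∀ x, x ∈ (c.rotate u hu).support ↔ x ∈ c.support := fun x => by simp
    have he : ∀ e, e ∈ (c.rotate u hu).edges ↔ e ∈ c.edges :=
      fun e => (c.rotate_edges u hu).perm.mem_iff
    have := this (c := c.rotate u hu) (by simpa using hc) (by simpa using hlen)
      (by simpa only [hs, he] using hch) (by simp) rfl
    simpa only [hs] using this
  subst huv
  have hinj := hc.getVert_injOn
  have h1 : G.Adj u (c.getVert 1) := by
    have := c.adj_getVert_succ (i := 0) (by omega)
    simpa using this
  have hpen : G.Adj u (c.getVert (c.length - 1)) := by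
    have := c.adj_getVert_succ (i := c.length - 1) (by omega)
    rw [Nat.sub_add_cancel (by omega), c.getVert_length] at this
    exact this.symm
  refine ⟨c.getVert 1, c.getVert_mem_support _, c.getVert (c.length - 1),
    c.getVert_mem_support _, h1, hpen, fun h => ?_, fun h => ?_⟩
  · have := hinj (show 1 ∈ {i | 1 ≤ i ∧ i ≤ c.length} by simp; omega)
      (show c.length - 1 ∈ {i | 1 ≤ i ∧ i ≤ c.length} by simp; omega) h
    omega
  · have hedge := hch _ (c.getVert_mem_support _) _ (c.getVert_mem_support _) h
    have hmem : c.getVert (c.length - 1) ∈ c.toSubgraph.neighborSet (c.getVert 1) := by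
      rw [SimpleGraph.Subgraph.mem_neighborSet]
      rwa [← SimpleGraph.Subgraph.mem_edgeSet, SimpleGraph.Walk.mem_edges_toSubgraph]
    rw [hc.neighborSet_toSubgraph_internal (by omega) (by omega)] at hmem
    rcases hmem with h0 | h2
    · rw [Nat.sub_self, c.getVert_zero] at h0
      exact hpen.ne h0.symm
    · have := hinj (show c.length - 1 ∈ {i | 1 ≤ i ∧ i ≤ c.length} by simp; omega)
        (show 1 + 1 ∈ {i | 1 ≤ i ∧ i ≤ c.length} by simp; omega) h2
      omega

/-- If `G[D]` is connected, a vertex of `D` other than some `w ∈ D` has a neighbour in `D`. -/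
theorem exists_adj_mem_of_induce_connected {V : Type} {G : SimpleGraph V} {D : Set V}
    (h : (G.induce D).Connected) {v w : V} (hv : v ∈ D) (hw : w ∈ D) (hvw : v ≠ w) :
    ∃ u ∈ D, G.Adj v u := by
  obtain ⟨p⟩ := h.preconnected ⟨v, hv⟩ ⟨w, hw⟩
  cases p with
  | nil => exact absurd rfl hvw
  | cons hadj _ => exact ⟨_, Subtype.property _, hadj⟩

/-- A graph in which every vertex is within distance two of a fixed one is connected. -/
theorem induce_connected_of_radius_two {V : Type} {G : SimpleGraph V} {D : Set V} {r : V}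
    (hr : r ∈ D)
    (h : ∀ v ∈ D, v = r ∨ G.Adj r v ∨ ∃ w ∈ D, G.Adj r w ∧ G.Adj w v) :
    (G.induce D).Connected := by
  have hreach : ∀ v : D, (G.induce D).Reachable ⟨r, hr⟩ v := by
    rintro ⟨v, hv⟩
    rcases h v hv with rfl | hadj | ⟨w, hw, h1, h2⟩
    · exact .refl _
    · exact SimpleGraph.Adj.reachable (G := G.induce D) (v := ⟨v, hv⟩) hadj
    · exact (SimpleGraph.Adj.reachable (G := G.induce D) (u := ⟨r, hr⟩) (v := ⟨w, hw⟩) h1).trans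
        (SimpleGraph.Adj.reachable (G := G.induce D) (u := ⟨w, hw⟩) (v := ⟨v, hv⟩) h2)
  exact (SimpleGraph.connected_iff_exists_forall_reachable _).2 ⟨_, hreach⟩

/-- The 3-sun: a triangle `0, 1, 2` together with a vertex of degree two attached to each of
its edges. -/
def threeSun : SimpleGraph (Fin 6) :=
  SimpleGraph.fromEdgeSet
    (({s(0, 1), s(1, 2), s(0, 2), s(3, 0), s(3, 1), s(4, 1), s(4, 2), s(5, 0), s(5, 2)} :
      Finset (Sym2 (Fin 6))) : Set (Sym2 (Fin 6)))

instance : DecidableRel threeSun.Adj := fun a b =>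
  decidable_of_iff (s(a, b) ∈ ({s(0, 1), s(1, 2), s(0, 2), s(3, 0), s(3, 1), s(4, 1), s(4, 2),
    s(5, 0), s(5, 2)} : Finset (Sym2 (Fin 6))) ∧ a ≠ b) (by
      rw [threeSun, SimpleGraph.fromEdgeSet_adj, Finset.mem_coe])

theorem isChordal_threeSun : IsChordal threeSun := by
  rintro ⟨v, c, hc, hlen, hch⟩
  have key := fun u (hu : u ∈ c.support) =>
    exists_nonadj_neighbors_of_chordless_cycle hc hlen hch hu
  have hsimp : ∀ u : Fin 6, 3 ≤ u → ∀ x y, threeSun.Adj u x → threeSun.Adj u y → x ≠ y →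
      threeSun.Adj x y := by decide
  have hlow : ∀ u ∈ c.support, u < 3 := by
    intro u hu
    by_contra! h
    obtain ⟨x, _, y, _, hx, hy, hne, hxy⟩ := key u hu
    exact hxy (hsimp u h x y hx hy hne)
  have hclique : ∀ x y : Fin 6, x < 3 → y < 3 → x ≠ y → threeSun.Adj x y := by decide
  obtain ⟨x, hx, y, hy, _, _, hne, hxy⟩ := key v c.start_mem_support
  exact hxy (hclique x y (hlow x hx) (hlow y hy) hne)

theorem kConnected_threeSun : KConnected threeSun 2 := by
  refine ⟨by simp, fun S hS => ?_⟩
  have hcenter : ∀ S : Finset (Fin 6), S.card < 2 → ∃ r ∉ S, ∀ v ∉ S,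
      v = r ∨ threeSun.Adj r v ∨ ∃ w ∉ S, threeSun.Adj r w ∧ threeSun.Adj w v := by
    intro S hS
    rcases Finset.card_le_one_iff_subset_singleton.1 (Nat.le_of_lt_succ hS) with ⟨a, ha⟩
    rcases Finset.subset_singleton_iff.1 ha with rfl | rfl
    · decide
    · revert a
      decide
  obtain ⟨r, hr, h⟩ := hcenter S hS
  exact induce_connected_of_radius_two (r := r) (by simpa using hr) (by simpa using h)

theorem not_hasCDSPartition_threeSun : ¬ HasCDSPartition threeSun 2 := by
  classical
  rintro ⟨D, hdisj, hcover, hD⟩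
  have hcompl : ∀ v, v ∈ D 1 ↔ v ∉ D 0 := by
    intro v
    refine ⟨fun h1 h0 => Set.disjoint_left.1 (hdisj (by decide : (0 : Fin 2) ≠ 1)) h0 h1,
      fun h0 => ?_⟩
    obtain ⟨i, hi⟩ := Set.mem_iUnion.1 (hcover ▸ Set.mem_univ v)
    fin_cases i
    · exact absurd hi h0
    · exact hi
  have hcolor : ∀ p : Fin 6 → Bool, ¬ ∀ b,
      (∀ v, p v = b ∨ ∃ u, p u = b ∧ threeSun.Adj v u) ∧
      ∀ v w, p v = b → p w = b → v ≠ w → ∃ u, p u = b ∧ threeSun.Adj v u := by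
    decide
  refine hcolor (fun v => decide (v ∈ D 0)) fun b => ?_
  obtain ⟨i, hi⟩ : ∃ i, ∀ v, decide (v ∈ D 0) = b ↔ v ∈ D i := by
    cases b
    · exact ⟨1, fun v => by simp [hcompl]⟩
    · exact ⟨0, fun v => by simp⟩
  simp only [hi]
  exact ⟨(hD i).2, fun v w hv hw hvw => exists_adj_mem_of_induce_connected (hD i).1 hv hw hvw⟩

/-- There is a `2`-connected chordal graph with no CDS partition of size `2`. -/
theorem exists_chordal_no_cds_partition :
    ∃ (n : ℕ) (G : SimpleGraph (Fin n)),
      IsChordal G ∧ KConnected G 2 ∧ ¬ HasCDSPartition G 2 :=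
  ⟨6, threeSun, isChordal_threeSun, kConnected_threeSun, not_hasCDSPartition_threeSun⟩
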